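/- Let T be a complete first-order theory, M a model of T, and Γ a uniformly λ-co-simple local bigness notion for T. Assume: (a) p is a Γ-big type over A in M, with A_Γ ⊆ A ⊆ M, and ā is a ζ-tuple from M; (b) ā_i is a ζ-tuple from A for each i < α, and D is a λ-complete filter on α; (c) for every formula φ(ȳ, b̄) with b̄ ⊆ A: if M ⊨ φ(ā, b̄), then {i < α : M ⊨ φ(ā_i, b̄)} ∈ D. Then p can be extended to a Γ-big complete type q over A ∪ ā in M such that for every formula φ(x̄_Γ, ȳ, b̄) with b̄ ⊆ A: if {i < α : φ(x̄_Γ, ā_i, b̄) ∈ q} ∈ D, then φ(x̄_Γ, ā, b̄) ∈ q. Consequently, if c̄ realizes q in an elementary extension N of M, then tp(ā, A ∪ c̄, N) is Γ^av_{D,⟨ā_i⟩}-big, where Γ^av_{D,⟨ā_i⟩} declares a formula ψ(ȳ, d̄) big in N iff the complement of {i < α : N ⊨ ψ(ā_i, d̄)} is not in D. -/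

import Mathlib

namespace Shelah482

open FirstOrder Language Cardinal

universe u

variable {L : FirstOrder.Language.{u, u}} {T : L.Theory} {γ : Type u}

/-- The conjunction of a finite list of formulas. -/
def listConj {α : Type u} : List (L.Formula α) → L.Formula α
  | [] => ⊤
  | φ :: l => φ ⊓ listConj l

/-- A *local bigness notion* `Γ` for a theory `T` (here the parameter set `A_Γ` of `Γ`
is absorbed into the language as constant symbols, so that all models of the complete
theory `T` elementarily extend `M_Γ` after naming these parameters): for every model
`M` of `T` it declares certain formulas `φ(x̄_Γ, ā)` with parameters `ā` from `M` to be
*`Γ`-big* (the remaining ones being *`Γ`-small*), in such a way that the `Γ`-small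
formulas form a proper ideal which is preserved by all automorphisms of `M` (such
automorphisms automatically fix the parameters `A_Γ`, being constants, pointwise). -/
structure LocalBigness (L : FirstOrder.Language.{u, u}) (T : L.Theory) (γ : Type u) :
    Type (u + 1) where
  Big : ∀ M : Theory.ModelType.{u, u, u} T, L.Formula (γ ⊕ M) → Prop
  aut_invariant : ∀ (M : Theory.ModelType.{u, u, u} T) (g : M ≃[L] M)
      (φ : L.Formula (γ ⊕ M)), Big M (φ.relabel (Sum.map id ⇑g)) ↔ Big M φ
  mono : ∀ (M : Theory.ModelType.{u, u, u} T) (φ ψ : L.Formula (γ ⊕ M)),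
      (∀ x : γ → M, φ.Realize (Sum.elim x id) → ψ.Realize (Sum.elim x id)) →
      Big M φ → Big M ψ
  small_sup : ∀ (M : Theory.ModelType.{u, u, u} T) (φ ψ : L.Formula (γ ⊕ M)),
      ¬ Big M φ → ¬ Big M ψ → ¬ Big M (φ ⊔ ψ)
  small_bot : ∀ M : Theory.ModelType.{u, u, u} T, ¬ Big M (⊥ : L.Formula (γ ⊕ M))
  exists_big : ∀ M : Theory.ModelType.{u, u, u} T, ∃ φ, Big M φ

/-- A (partial) type `p` over `A ⊆ M` is `Γ`-big in `M` if the conjunction of every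
finite subset of `p` is a `Γ`-big formula in `M`. -/
def LocalBigness.BigType (Γ : LocalBigness L T γ) (M : Theory.ModelType.{u, u, u} T)
    (A : Set M) (p : Set (L.Formula (γ ⊕ ↥A))) : Prop :=
  ∀ l : List (L.Formula (γ ⊕ ↥A)), (∀ φ ∈ l, φ ∈ p) →
    Γ.Big M ((listConj l).relabel (Sum.map id Subtype.val))

/-- `q` is a complete type over `A` in `M` (in the variables `γ`): a maximal set of
formulas with parameters in `A` which is consistent with the elementary diagram of
`M`, i.e. finitely satisfiable in `M`. -/
def IsCompleteTypeOver (M : Theory.ModelType.{u, u, u} T) (A : Set M)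
    (q : Set (L.Formula (γ ⊕ ↥A))) : Prop :=
  (∀ l : List (L.Formula (γ ⊕ ↥A)), (∀ φ ∈ l, φ ∈ q) →
      ∃ x : γ → M, (listConj l).Realize (Sum.elim x Subtype.val)) ∧
  (∀ φ : L.Formula (γ ⊕ ↥A), φ ∈ q ∨ φ.not ∈ q)

/-- A local bigness notion `Γ` is *uniformly `λ`-co-simple* if for every formula
`φ(x̄_Γ, ȳ)` there is a type `q_φ(ȳ)` over `A_Γ` of fewer than `λ` formulas such that
for every model `M` and tuple `ā`: `φ(x̄_Γ, ā)` is `Γ`-small in `M` iff `ā` realizes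
`q_φ`. -/
def LocalBigness.UniformlyCoSimple (Γ : LocalBigness L T γ) (lam : Cardinal.{u}) :
    Prop :=
  ∀ (n : ℕ) (φ : L.Formula (γ ⊕ Fin n)),
    ∃ q : Set (L.Formula (Fin n)), Cardinal.mk ↥q < lam ∧
      ∀ (M : Theory.ModelType.{u, u, u} T) (a : Fin n → M),
        (¬ Γ.Big M (φ.relabel (Sum.map id a)) ↔ ∀ ψ ∈ q, ψ.Realize a)

/-- Substituting a tuple `c̄` of elements of `B` for the variables `ȳ` (of sort `ζ`)
in a formula `φ(x̄_Γ, ȳ, b̄)` with parameters `b̄ ⊆ A ⊆ B`, yielding a formula in the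
variables `x̄_Γ` with parameters in `B`. -/
def substParams {M : Theory.ModelType.{u, u, u} T} {ζ : Type u} {A B : Set M}
    (c : ζ → M) (hc : ∀ z, c z ∈ B) (hAB : A ⊆ B)
    (φ : L.Formula (γ ⊕ (ζ ⊕ ↥A))) : L.Formula (γ ⊕ ↥B) :=
  φ.relabel
    (Sum.map id (Sum.elim (fun z => (⟨c z, hc z⟩ : ↥B)) (Set.inclusion hAB)))

theorem realize_listConj {N α : Type u} [L.Structure N] (l : List (L.Formula α)) (v : α → N) :
    (listConj l).Realize v ↔ ∀ φ ∈ l, φ.Realize v := by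
  induction l with
  | nil => simp [listConj]
  | cons φ l ih => simp [listConj, ih]

theorem realize_relabel_map {N : Type u} {α δ : Type*} [L.Structure N] (f : α → δ)
    (φ : L.Formula (γ ⊕ α)) (x : γ → N) (v : δ → N) :
    (φ.relabel (Sum.map id f)).Realize (Sum.elim x v) ↔ φ.Realize (Sum.elim x (v ∘ f)) := by
  rw [Formula.realize_relabel, Sum.elim_comp_map, Function.comp_id]

theorem realize_substParams {M : Theory.ModelType.{u, u, u} T} {ζ : Type u} {A B : Set M}
    (c : ζ → M) (hc : ∀ z, c z ∈ B) (hAB : A ⊆ B) (φ : L.Formula (γ ⊕ (ζ ⊕ ↥A)))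
    {N : Type u} [L.Structure N] (x : γ → N) (e : M → N) :
    (substParams c hc hAB φ).Realize (Sum.elim x fun b => e b.val) ↔
      φ.Realize (Sum.elim x (Sum.elim (fun z => e (c z)) fun b => e b.val)) := by
  rw [substParams, realize_relabel_map]
  apply iff_of_eq
  congr 2
  funext z
  rcases z with z | z <;> rfl

/-- Every formula in parameters `δ` is equivalent to one using only finitely many of them. -/
theorem exists_finite_params {δ : Type u} (φ : L.Formula (γ ⊕ δ)) :
    ∃ (n : ℕ) (ψ : L.Formula (γ ⊕ Fin n)) (f : Fin n → δ),
      ∀ (N : Type u) [L.Structure N] (x : γ → N) (v : δ → N),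
        ψ.Realize (Sum.elim x (v ∘ f)) ↔ φ.Realize (Sum.elim x v) := by
  classical
  let S : Set δ := {d | Sum.inr d ∈ φ.freeVarFinset}
  have hS : S.Finite := φ.freeVarFinset.finite_toSet.preimage Sum.inr_injective.injOn
  have : Finite S := hS
  obtain ⟨n, ⟨e⟩⟩ := Finite.exists_equiv_fin S
  let f : φ.freeVarFinset → γ ⊕ Fin n := fun
    | ⟨Sum.inl g, _⟩ => Sum.inl g
    | ⟨Sum.inr d, h⟩ => Sum.inr (e ⟨d, h⟩)
  refine ⟨n, BoundedFormula.restrictFreeVar φ f, fun k => (e.symm k).val, fun N _ x v => ?_⟩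
  refine BoundedFormula.realize_restrictFreeVar _ ?_
  rintro ⟨g | d, h⟩ <;> simp [f]

theorem LocalBigness.big_congr (Γ : LocalBigness L T γ) (M : Theory.ModelType.{u, u, u} T)
    {φ ψ : L.Formula (γ ⊕ M)}
    (h : ∀ x : γ → M, φ.Realize (Sum.elim x id) ↔ ψ.Realize (Sum.elim x id)) :
    Γ.Big M φ ↔ Γ.Big M ψ :=
  ⟨Γ.mono M _ _ fun x => (h x).1, Γ.mono M _ _ fun x => (h x).2⟩

theorem LocalBigness.exists_realize_of_big (Γ : LocalBigness L T γ)
    (M : Theory.ModelType.{u, u, u} T) {φ : L.Formula (γ ⊕ M)} (h : Γ.Big M φ) :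
    ∃ x : γ → M, φ.Realize (Sum.elim x id) := by
  by_contra! hn
  exact Γ.small_bot M (Γ.mono M _ _ (fun x hx => absurd hx (hn x)) h)

theorem realize_relabel_val {M : Type u} [L.Structure M] {A : Set M}
    (φ : L.Formula (γ ⊕ ↥A)) (x : γ → M) :
    (φ.relabel (Sum.map id Subtype.val)).Realize (Sum.elim x id) ↔
      φ.Realize (Sum.elim x Subtype.val) :=
  realize_relabel_map _ _ _ _

/-- Every `Γ`-big type extends to a `Γ`-big complete type over the same parameters. -/
theorem LocalBigness.BigType.exists_complete {Γ : LocalBigness L T γ}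
    {M : Theory.ModelType.{u, u, u} T} {B : Set M} {p : Set (L.Formula (γ ⊕ ↥B))}
    (hp : Γ.BigType M B p) :
    ∃ q, p ⊆ q ∧ Γ.BigType M B q ∧ IsCompleteTypeOver M B q := by
  classical
  have hfin : Order.IsOfFiniteCharacter {q | Γ.BigType M B q} := by
    refine fun q => ⟨fun hq y hy _ l hl => hq l fun φ h => hy (hl φ h), fun hq l hl => ?_⟩
    exact hq {φ | φ ∈ l} hl l.finite_toSet l fun _ h => h
  obtain ⟨q, hpq, hmax⟩ := hfin.exists_maximal hp
  have hq : Γ.BigType M B q := hmax.prop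
  refine ⟨q, hpq, hq, fun l hl => ?_, fun φ => ?_⟩
  · obtain ⟨x, hx⟩ := Γ.exists_realize_of_big M (hq l hl)
    exact ⟨x, (realize_relabel_val _ x).1 hx⟩
  · by_contra! hn
    have key : ∀ χ, χ ∉ q → ∃ l : List (L.Formula (γ ⊕ ↥B)), (∀ θ ∈ l, θ ∈ insert χ q) ∧
        ¬ Γ.Big M ((listConj l).relabel (Sum.map id Subtype.val)) := by
      intro χ hχ
      by_contra! hb
      exact hχ (hmax.le_of_ge (y := insert χ q) hb (Set.subset_insert _ _)
        (Set.mem_insert _ _))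
    obtain ⟨l₁, hl₁, hs₁⟩ := key _ hn.1
    obtain ⟨l₂, hl₂, hs₂⟩ := key _ hn.2
    refine Γ.small_sup M _ _ hs₁ hs₂ (Γ.mono M _ _ ?_
      (hq ((l₁ ++ l₂).filter (· ∈ q)) fun θ hθ => by simpa using (List.mem_filter.1 hθ).2))
    intro x hx
    rw [realize_relabel_val, realize_listConj] at hx
    simp only [List.mem_filter, List.mem_append, decide_eq_true_eq, and_imp] at hx
    rw [Formula.realize_sup, realize_relabel_val, realize_relabel_val, realize_listConj,
      realize_listConj]
    by_cases hφ : φ.Realize (Sum.elim x Subtype.val)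
    · left
      intro θ hθ
      rcases hl₁ θ hθ with rfl | h
      · exact hφ
      · exact hx θ (Or.inl hθ) h
    · right
      intro θ hθ
      rcases hl₂ θ hθ with rfl | h
      · exact Formula.realize_not.2 hφ
      · exact hx θ (Or.inr hθ) h

/-- A complete type contains every consequence of finitely many of its members. -/
theorem IsCompleteTypeOver.mem_of_realize {M : Theory.ModelType.{u, u, u} T} {B : Set M}
    {q : Set (L.Formula (γ ⊕ ↥B))} (hq : IsCompleteTypeOver M B q)
    (l : List (L.Formula (γ ⊕ ↥B))) (hl : ∀ φ ∈ l, φ ∈ q) (ψ : L.Formula (γ ⊕ ↥B))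
    (h : ∀ x : γ → M, (∀ φ ∈ l, φ.Realize (Sum.elim x Subtype.val)) →
      ψ.Realize (Sum.elim x Subtype.val)) : ψ ∈ q := by
  by_contra hψ
  obtain ⟨x, hx⟩ := hq.1 (ψ.not :: l) (by
    simpa using ⟨(hq.2 ψ).resolve_left hψ, hl⟩)
  rw [realize_listConj] at hx
  simp only [List.mem_cons, forall_eq_or_imp, Formula.realize_not] at hx
  exact hx.1 (h x hx.2)

/-- If bigness is co-simple, averages of formulas that are big along a `λ`-complete filter
are big. -/
theorem LocalBigness.UniformlyCoSimple.big_of_average {Γ : LocalBigness L T γ}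
    {lam : Cardinal.{u}} (hΓ : Γ.UniformlyCoSimple lam) (M : Theory.ModelType.{u, u, u} T)
    {ι δ : Type u} (v : δ → M) (vv : ι → δ → M) (D : Filter ι)
    (hD : ∀ S : Set (Set ι), Cardinal.mk ↥S < lam → (∀ s ∈ S, s ∈ D) → ⋂₀ S ∈ D)
    (hav : ∀ φ : L.Formula δ, φ.Realize v → {i | φ.Realize (vv i)} ∈ D)
    (φ : L.Formula (γ ⊕ δ))
    (hφ : ∃ᶠ i in D, Γ.Big M (φ.relabel (Sum.map id (vv i)))) :
    Γ.Big M (φ.relabel (Sum.map id v)) := by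
  obtain ⟨n, ψ, f, hψ⟩ := exists_finite_params φ
  obtain ⟨q, hqlam, hq⟩ := hΓ n ψ
  have hbig : ∀ w : δ → M, Γ.Big M (φ.relabel (Sum.map id w)) ↔
      Γ.Big M (ψ.relabel (Sum.map id (w ∘ f))) := fun w => Γ.big_congr M fun x => by
    rw [realize_relabel_map, realize_relabel_map, Function.id_comp, Function.id_comp, hψ]
  rw [hbig]
  by_contra hs
  rw [hq] at hs
  have hmem := hD ((fun χ : L.Formula (Fin n) => {i | χ.Realize (vv i ∘ f)}) '' q)
    (Cardinal.mk_image_le.trans_lt hqlam) (by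
      rintro _ ⟨χ, hχ, rfl⟩
      have := hav (χ.relabel f) (by rw [Formula.realize_relabel]; exact hs χ hχ)
      simpa only [Formula.realize_relabel] using this)
  obtain ⟨i, hi, hi'⟩ := (hφ.and_eventually hmem).exists
  rw [hbig] at hi
  exact (hq M (vv i ∘ f)).2 (fun χ hχ => hi' _ ⟨χ, hχ, rfl⟩) hi

/-!
Statement 10 (Lemma 2.10 together with Claim 2.8(3)): the averaging lemma for a
uniformly `λ`-co-simple local bigness notion `Γ` and a `λ`-complete filter `D`.
-/
theorem averaging_extension (hT : T.IsComplete) (lam : Cardinal.{u})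
    (Γ : LocalBigness L T γ) (hΓ : Γ.UniformlyCoSimple lam)
    (M : Theory.ModelType.{u, u, u} T) (A : Set M)
    -- (a) `p` is a `Γ`-big type over `A` in `M` and `ā` is a `ζ`-tuple from `M`
    (p : Set (L.Formula (γ ⊕ ↥A))) (hp : Γ.BigType M A p)
    {ζ : Type u} (a : ζ → M)
    -- (b) the `ā_i` are `ζ`-tuples from `A` and `D` is a `λ`-complete filter on `ι`
    {ι : Type u} (aa : ι → ζ → M) (haa : ∀ i z, aa i z ∈ A)
    (D : Filter ι) [D.NeBot]
    (hD : ∀ S : Set (Set ι), Cardinal.mk ↥S < lam → (∀ s ∈ S, s ∈ D) → ⋂₀ S ∈ D)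
    -- (c) every formula over `A` satisfied by `ā` is satisfied by `D`-many `ā_i`
    (hav : ∀ φ : L.Formula (ζ ⊕ ↥A), Formula.Realize φ (Sum.elim a Subtype.val) →
      { i : ι | Formula.Realize φ (Sum.elim (aa i) Subtype.val) } ∈ D) :
    -- then `p` extends to a `Γ`-big complete type `q` over `A ∪ ā` such that …
    ∃ q : Set (L.Formula (γ ⊕ ↥(A ∪ Set.range a))),
      (∀ φ ∈ p,
        Formula.relabel (Sum.map id (Set.inclusion Set.subset_union_left)) φ ∈ q) ∧
      IsCompleteTypeOver M (A ∪ Set.range a) q ∧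
      Γ.BigType M (A ∪ Set.range a) q ∧
      -- … for every formula `φ(x̄_Γ, ȳ, b̄)` with `b̄ ⊆ A`: if `D`-many of the
      -- substitution instances `φ(x̄_Γ, ā_i, b̄)` lie in `q`, then `φ(x̄_Γ, ā, b̄) ∈ q`
      (∀ φ : L.Formula (γ ⊕ (ζ ⊕ ↥A)),
        { i : ι | substParams (aa i) (fun z => Set.mem_union_left _ (haa i z))
            Set.subset_union_left φ ∈ q } ∈ D →
        substParams a (fun z => Set.mem_union_right _ (Set.mem_range_self z))
          Set.subset_union_left φ ∈ q) ∧
      -- consequently, if `c̄` realizes `q` in an elementary extension `N` of `M`, then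
      -- `tp(ā, A ∪ c̄, N)` is `Γ^av_{D,⟨ā_i⟩}`-big: every formula in it is satisfied
      -- by a set of `ā_i`'s which is `≠ ∅ mod D`
      ∀ (N : Theory.ModelType.{u, u, u} T) (emb : M ↪ₑ[L] N) (c : γ → N),
        (∀ φ ∈ q, Formula.Realize φ (Sum.elim c fun x => emb x.val)) →
        ∀ ψ : L.Formula (ζ ⊕ (γ ⊕ ↥A)),
          Formula.Realize ψ
            (Sum.elim (fun z => emb (a z)) (Sum.elim c fun x => emb x.val)) →
          { i : ι | Formula.Realize ψ
              (Sum.elim (fun z => emb (aa i z)) (Sum.elim c fun x => emb x.val)) }ᶜ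
            ∉ D := by
  have hAB : A ⊆ A ∪ Set.range a := Set.subset_union_left
  have haaB : ∀ i z, aa i z ∈ A ∪ Set.range a := fun i z => Set.mem_union_left _ (haa i z)
  have haB : ∀ z, a z ∈ A ∪ Set.range a := fun z => Set.mem_union_right _ (Set.mem_range_self z)
  have hsub : ∀ (c : ζ → M) (B : Set M) (hc : ∀ z, c z ∈ B) (hB : A ⊆ B)
      (φ : L.Formula (γ ⊕ (ζ ⊕ ↥A))) (x : γ → M),
      (substParams c hc hB φ).Realize (Sum.elim x Subtype.val) ↔
        φ.Realize (Sum.elim x (Sum.elim c Subtype.val)) :=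
    fun c B hc hB φ x => realize_substParams c hc hB φ x id
  obtain ⟨q₀, hpq₀, hbig₀, hcomp₀⟩ := hp.exists_complete
  let av (φ : L.Formula (γ ⊕ (ζ ⊕ ↥A))) : Prop :=
    ∀ᶠ i in D, substParams (aa i) (haa i) subset_rfl φ ∈ q₀
  have hav_big : ∀ φ, av φ → Γ.Big M (φ.relabel (Sum.map id (Sum.elim a Subtype.val))) := by
    intro φ hφ
    refine hΓ.big_of_average M _ (fun i => Sum.elim (aa i) Subtype.val) D hD hav φ
      (Filter.Eventually.frequently (hφ.mono fun i hi => ?_))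
    refine Γ.mono M _ _ (fun x hx => ?_) (hbig₀ [substParams (aa i) (haa i) subset_rfl φ]
      (by simpa using hi))
    rw [realize_relabel_val, realize_listConj] at hx
    rw [realize_relabel_map, Function.id_comp]
    exact (hsub _ _ _ _ _ _).1 (hx _ (List.mem_singleton_self _))
  have hconj : ∀ l : List (L.Formula (γ ⊕ (ζ ⊕ ↥A))), (∀ φ ∈ l, av φ) → av (listConj l) := by
    intro l hl
    have hl' : ∀ᶠ i in D, ∀ φ ∈ {φ | φ ∈ l}, substParams (aa i) (haa i) subset_rfl φ ∈ q₀ :=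
      (Filter.eventually_all_finite l.finite_toSet).2 hl
    refine hl'.mono fun i hi => hcomp₀.mem_of_realize
      (l.map (substParams (aa i) (haa i) subset_rfl)) (by simpa using hi) _ fun x hx => ?_
    rw [hsub, realize_listConj]
    exact fun φ hφ => (hsub _ _ _ _ _ _).1 (hx _ (List.mem_map_of_mem hφ))
  have hQ : Γ.BigType M (A ∪ Set.range a) (substParams a haB hAB '' {φ | av φ}) := by
    intro l hl
    obtain ⟨l, rfl, hl'⟩ : ∃ l' : List (L.Formula (γ ⊕ (ζ ⊕ ↥A))),
        l'.map (substParams a haB hAB) = l ∧ ∀ φ ∈ l', av φ := by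
      induction l with
      | nil => exact ⟨[], by simp⟩
      | cons χ l ih =>
        obtain ⟨φ, hφ, rfl⟩ := hl χ List.mem_cons_self
        obtain ⟨l', rfl, hl'⟩ := ih fun θ hθ => hl θ (List.mem_cons_of_mem _ hθ)
        exact ⟨φ :: l', rfl, by simpa using ⟨hφ, hl'⟩⟩
    refine Γ.mono M _ _ (fun x hx => ?_) (hav_big _ (hconj l hl'))
    rw [realize_relabel_map, Function.id_comp, realize_listConj] at hx
    rw [realize_relabel_val, realize_listConj, List.forall_mem_map]
    exact fun φ hφ => (hsub _ _ _ _ _ _).2 (hx φ hφ)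
  obtain ⟨q, hQq, hbig, hcomp⟩ := hQ.exists_complete
  have hq₀q : ∀ φ ∈ q₀, φ.relabel (Sum.map id (Set.inclusion hAB)) ∈ q := by
    intro φ hφ
    refine hcomp.mem_of_realize
      [substParams a haB hAB (φ.relabel (Sum.map id Sum.inr))] ?_ _ fun x hx => ?_
    · simp only [List.mem_singleton, forall_eq]
      refine hQq ⟨_, Filter.Eventually.of_forall fun i =>
        hcomp₀.mem_of_realize [φ] (by simpa using hφ) _ fun x hx => ?_, rfl⟩
      rw [hsub, realize_relabel_map]
      exact hx φ (List.mem_singleton_self _)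
    · have := hx _ (List.mem_singleton_self _)
      rw [hsub, realize_relabel_map] at this
      rw [realize_relabel_map]
      exact this
  have hq₀ : ∀ i φ, substParams (aa i) (haaB i) hAB φ ∈ q →
      substParams (aa i) (haa i) subset_rfl φ ∈ q₀ := by
    intro i φ hφ
    refine (hcomp₀.2 _).resolve_right fun hn => ?_
    obtain ⟨x, hx⟩ := hcomp.1 [_, _] (List.forall_mem_cons.2
      ⟨hφ, List.forall_mem_singleton.2 (hq₀q _ hn)⟩)
    rw [realize_listConj, List.forall_mem_cons, List.forall_mem_singleton, hsub, realize_relabel_map,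
      Formula.realize_not] at hx
    exact hx.2 ((hsub _ _ _ _ _ _).2 hx.1)
  have havg : ∀ φ : L.Formula (γ ⊕ (ζ ⊕ ↥A)),
      {i | substParams (aa i) (haaB i) hAB φ ∈ q} ∈ D → substParams a haB hAB φ ∈ q :=
    fun φ hφ => hQq ⟨φ, Filter.mem_of_superset hφ fun i hi => hq₀ i φ hi, rfl⟩
  refine ⟨q, fun φ hφ => hq₀q φ (hpq₀ hφ), hcomp, hbig, havg, ?_⟩
  intro N emb c hc ψ hψ hD'
  let σ : ζ ⊕ (γ ⊕ ↥A) → γ ⊕ (ζ ⊕ ↥A) :=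
    Sum.elim (Sum.inr ∘ Sum.inl) (Sum.map id Sum.inr)
  have hσ : ∀ w : ζ → N, (ψ.relabel σ).Realize
      (Sum.elim c (Sum.elim w fun x : A => emb x.val)) ↔
      ψ.Realize (Sum.elim w (Sum.elim c fun x : A => emb x.val)) := by
    intro w
    rw [Formula.realize_relabel]
    apply iff_of_eq
    congr 1
    funext z
    rcases z with z | z | z <;> rfl
  have hmem := havg (ψ.relabel σ).not (Filter.mem_of_superset hD' fun i hi => by
    refine (hcomp.2 (substParams (aa i) (haaB i) hAB (ψ.relabel σ))).resolve_left fun h => hi ?_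
    exact (hσ _).1 ((realize_substParams _ _ _ _ _ _).1 (hc _ h)))
  have := (realize_substParams _ _ _ _ _ _).1 (hc _ hmem)
  exact Formula.realize_not.1 this ((hσ _).2 hψ)

end Shelah482
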